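/- Let G be a dense, K_4^3 ∪ e-free 3-graph with λ(G) > √3/18. Then G is X_3-free, where X_3 is the 3-graph on vertex set {1,...,8} whose edges are the four triples inside each of the 4-sets {1,2,3,4}, {1,2,5,6}, {1,2,7,8} (three copies of K_4^3 all sharing the two vertices 1,2). -/

import Mathlib

open Finset

/-- An `r`-uniform hypergraph (r-graph) with vertices drawn from `ℕ`. -/
structure HyperGraph (r : ℕ) where
  verts : Finset ℕ
  edges : Finset (Finset ℕ)
  edges_sub : ∀ e ∈ edges, e ⊆ verts
  card_eq : ∀ e ∈ edges, e.card = r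

/-- A 3-uniform hypergraph (3-graph). -/
abbrev ThreeGraph := HyperGraph 3

/-- A feasible weight vector on `G`: nonnegative weights on the vertices summing to 1. -/
def HyperGraph.IsFeasible {r : ℕ} (G : HyperGraph r) (w : ℕ → ℝ) : Prop :=
  (∀ v ∈ G.verts, 0 ≤ w v) ∧ ∑ v ∈ G.verts, w v = 1

/-- The Lagrangian function `λ(G, w) = Σ_{e ∈ E(G)} Π_{v ∈ e} w v`. -/
noncomputable def HyperGraph.lagFun {r : ℕ} (G : HyperGraph r) (w : ℕ → ℝ) : ℝ :=
  ∑ e ∈ G.edges, ∏ v ∈ e, w v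

/-- The Lagrangian `λ(G)`: the maximum of `λ(G, w)` over feasible weight vectors. -/
noncomputable def HyperGraph.lag {r : ℕ} (G : HyperGraph r) : ℝ :=
  sSup {x : ℝ | ∃ w, G.IsFeasible w ∧ G.lagFun w = x}

/-- `G` contains a copy of `F`: an injection of the vertices of `F` into those of `G`
mapping every edge of `F` to an edge of `G`. -/
def HyperGraph.ContainsCopy {r : ℕ} (G F : HyperGraph r) : Prop :=
  ∃ f : ℕ → ℕ, Set.InjOn f ↑F.verts ∧ (∀ v ∈ F.verts, f v ∈ G.verts) ∧
    ∀ e ∈ F.edges, e.image f ∈ G.edges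

/-- `G` is `F`-free. -/
def HyperGraph.Free {r : ℕ} (G F : HyperGraph r) : Prop := ¬ G.ContainsCopy F

/-- `H` is a subgraph of `G`. -/
def HyperGraph.IsSubgraph {r : ℕ} (H G : HyperGraph r) : Prop :=
  H.verts ⊆ G.verts ∧ H.edges ⊆ G.edges

/-- `G` is dense: every proper subgraph has strictly smaller Lagrangian. -/
def HyperGraph.LagDense {r : ℕ} (G : HyperGraph r) : Prop :=
  ∀ H : HyperGraph r, H.IsSubgraph G → (H.verts ≠ G.verts ∨ H.edges ≠ G.edges) →
    H.lag < G.lag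

/-- The Lagrangian density `π_λ(F) = sup { r! · λ(G) : G is F-free }`. -/
noncomputable def lagDensity {r : ℕ} (F : HyperGraph r) : ℝ :=
  sSup {x : ℝ | ∃ G : HyperGraph r, G.Free F ∧ x = (Nat.factorial r : ℝ) * G.lag}

/-- An optimum weight vector for `G`. -/
def HyperGraph.IsOptimal {r : ℕ} (G : HyperGraph r) (w : ℕ → ℝ) : Prop :=
  G.IsFeasible w ∧ G.lagFun w = G.lag

/-- `K_4^3 ∪ e`: the disjoint union of the complete 3-graph on `{1,2,3,4}`
and the single edge `{5,6,7}`. -/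
def K43e : ThreeGraph where
  verts := {1, 2, 3, 4, 5, 6, 7}
  edges := {{1, 2, 3}, {1, 2, 4}, {1, 3, 4}, {2, 3, 4}, {5, 6, 7}}
  edges_sub := by decide
  card_eq := by decide

/-- `X_3`: three copies of `K_4^3` all sharing the two vertices `1, 2`. -/
def X3 : ThreeGraph where
  verts := {1, 2, 3, 4, 5, 6, 7, 8}
  edges := {{1, 2, 3}, {1, 2, 4}, {1, 3, 4}, {2, 3, 4},
    {1, 2, 5}, {1, 2, 6}, {1, 5, 6}, {2, 5, 6},
    {1, 2, 7}, {1, 2, 8}, {1, 7, 8}, {2, 7, 8}}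
  edges_sub := by decide
  card_eq := by decide

/-- The elementary symmetric sum of degree two. -/
theorem aux_esymm_two (R : Finset ℕ) (w : ℕ → ℝ) :
    2 * (∑ P ∈ R.powersetCard 2, ∏ v ∈ P, w v) + ∑ v ∈ R, w v ^ 2 = (∑ v ∈ R, w v) ^ 2 := by
  induction R using Finset.induction_on with
  | empty => simp [show Finset.powersetCard 2 (∅ : Finset ℕ) = ∅ from rfl]
  | insert a s ha ih =>
    rw [Finset.powersetCard_succ_insert ha, Finset.sum_union, Finset.sum_image,
      Finset.sum_insert ha, Finset.sum_insert ha, Finset.powersetCard_one, Finset.sum_map]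
    · have : ∀ v ∈ s, ∏ u ∈ insert a ((⟨singleton, Finset.singleton_injective⟩ : ℕ ↪ Finset ℕ) v),
          w u = w a * w v := by
        intro v hv
        have hne : a ≠ v := fun h => ha (h ▸ hv)
        simp [Finset.prod_pair hne]
      rw [Finset.sum_congr rfl this, ← Finset.mul_sum]
      linarith [ih]
    · intro x hx y hy hxy
      rw [Finset.mem_coe, Finset.mem_powersetCard] at hx hy
      have hax : a ∉ x := fun h => ha (hx.1 h)
      have hay : a ∉ y := fun h => ha (hy.1 h)
      rw [← Finset.erase_insert hax, ← Finset.erase_insert hay]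
      exact congrArg (fun z => Finset.erase z a) hxy
    · rw [Finset.disjoint_left]
      intro x hx hx'
      rw [Finset.mem_powersetCard] at hx
      obtain ⟨y, -, rfl⟩ := Finset.mem_image.1 hx'
      exact ha (hx.1 (Finset.mem_insert_self a y))

/-- Edge sums over a family covered by an image are bounded by the sum over the domain. -/
theorem aux_sum_le {ι : Type} [Nonempty ι] [DecidableEq ι] (E : Finset (Finset ℕ)) (D : Finset ι)
    (g : ι → Finset ℕ) (f : Finset ℕ → ℝ) (h : ∀ e ∈ E, ∃ d ∈ D, g d = e)
    (hf : ∀ d ∈ D, 0 ≤ f (g d)) : ∑ e ∈ E, f e ≤ ∑ d ∈ D, f (g d) := by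
  choose! k hk using h
  calc ∑ e ∈ E, f e = ∑ e ∈ E, f (g (k e)) :=
        Finset.sum_congr rfl fun e he => by rw [(hk e he).2]
    _ = ∑ d ∈ E.image k, f (g d) := by
        rw [Finset.sum_image]
        intro x hx y hy hxy
        rw [← (hk x hx).2, ← (hk y hy).2, hxy]
    _ ≤ _ := Finset.sum_le_sum_of_subset_of_nonneg
        (by
          intro d hd
          obtain ⟨e, he, rfl⟩ := Finset.mem_image.1 hd
          exact (hk e he).1)
        (fun d hd _ => hf d hd)

/-- The analytic inequality. -/
theorem aux_ineq (x y t p q r : ℝ) (hx : 0 ≤ x) (hy : 0 ≤ y) (ht : 0 ≤ t) (hp : 0 ≤ p)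
    (hq : 0 ≤ q) (hr : 0 ≤ r) (hs : x + y + t = 1) (hpqr : p + q + r ≤ t) :
    x * y * t + (x + y) * ((t ^ 2 - (p ^ 2 + q ^ 2 + r ^ 2) / 2) / 2) + p * q * r
      ≤ Real.sqrt 3 / 18 := by
  obtain ⟨s, hsd⟩ : ∃ s, s = x + y := ⟨_, rfl⟩
  obtain ⟨σ, hσ⟩ : ∃ σ, σ = p + q + r := ⟨_, rfl⟩
  have hs0 : 0 ≤ s := by rw [hsd]; positivity
  have hσ0 : 0 ≤ σ := by rw [hσ]; positivity
  have hst : s = 1 - t := by linarith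
  have hσt : σ ≤ t := by linarith
  have h1 : x * y * t ≤ s ^ 2 / 4 * t := by
    apply mul_le_mul_of_nonneg_right _ ht
    rw [hsd]; nlinarith [sq_nonneg (x - y)]
  have h2 : σ ^ 2 / 3 ≤ p ^ 2 + q ^ 2 + r ^ 2 := by
    rw [hσ]; nlinarith [sq_nonneg (p - q), sq_nonneg (p - r), sq_nonneg (q - r)]
  have h3 : p * q * r ≤ σ ^ 3 / 27 := by
    rw [hσ]
    nlinarith [mul_nonneg hp (sq_nonneg (q - r)), mul_nonneg hq (sq_nonneg (p - r)),
      mul_nonneg hr (sq_nonneg (p - q)), mul_nonneg hp (sq_nonneg (p - r)),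
      mul_nonneg hp (sq_nonneg (p - q)), mul_nonneg hq (sq_nonneg (q - r)),
      mul_nonneg hq (sq_nonneg (q - p)), mul_nonneg hr (sq_nonneg (r - p)),
      mul_nonneg hr (sq_nonneg (r - q))]
  have h4 : s * (σ ^ 2 / 3) ≤ s * (p ^ 2 + q ^ 2 + r ^ 2) := mul_le_mul_of_nonneg_left h2 hs0
  have key : x * y * t + (x + y) * ((t ^ 2 - (p ^ 2 + q ^ 2 + r ^ 2) / 2) / 2) + p * q * r
      ≤ (t - t ^ 3) / 4 + σ ^ 2 * (σ / 27 - s / 12) := by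
    have e : s ^ 2 / 4 * t + s * t ^ 2 / 2 = (t - t ^ 3) / 4 := by rw [hst]; ring
    rw [← hsd]
    nlinarith
  refine key.trans ?_
  have hk0 : 0 ≤ Real.sqrt 3 := Real.sqrt_nonneg 3
  have hk : Real.sqrt 3 ^ 2 = 3 := Real.sq_sqrt (by norm_num)
  by_cases hc : σ / 27 - s / 12 ≤ 0
  · have h5 : σ ^ 2 * (σ / 27 - s / 12) ≤ 0 := mul_nonpos_of_nonneg_of_nonpos (sq_nonneg σ) hc
    have h6 : 0 ≤ (t - Real.sqrt 3 / 3) ^ 2 * (t + 2 * Real.sqrt 3 / 3) := by positivity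
    have e : (t - Real.sqrt 3 / 3) ^ 2 * (t + 2 * Real.sqrt 3 / 3)
        = t ^ 3 - Real.sqrt 3 ^ 2 * t / 3 + 2 * Real.sqrt 3 ^ 2 * Real.sqrt 3 / 27 := by ring
    rw [e, hk] at h6
    linarith
  · push Not at hc
    have hk1 : (1.73 : ℝ) ≤ Real.sqrt 3 := Real.le_sqrt_of_sq_le (by norm_num)
    have h5 : σ ^ 2 * (σ / 27 - s / 12) ≤ t ^ 2 * (t / 27 - s / 12) := by
      apply mul_le_mul _ _ hc.le (sq_nonneg t)
      · exact pow_le_pow_left₀ hσ0 hσt 2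
      · linarith
    have h6 : (t - t ^ 3) / 4 + t ^ 2 * (t / 27 - s / 12) ≤ 0.096 := by
      rw [hst]
      nlinarith [mul_nonneg ht (sq_nonneg (t - 0.616)), sq_nonneg (t - 0.616)]
    linarith

/-- The upper bound for the weight polynomial. -/
theorem aux_bound (G : ThreeGraph) (a b c₁ d₁ c₂ d₂ c₃ d₃ : ℕ)
    (hnd : [a, b, c₁, d₁, c₂, d₂, c₃, d₃].Nodup)
    (hV : ∀ v ∈ [a, b, c₁, d₁, c₂, d₂, c₃, d₃], v ∈ G.verts)
    (hE : ∀ e ∈ G.edges, a ∉ e → b ∉ e →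
      (c₁ ∈ e ∨ d₁ ∈ e) ∧ (c₂ ∈ e ∨ d₂ ∈ e) ∧ (c₃ ∈ e ∨ d₃ ∈ e))
    (w : ℕ → ℝ) (hw : G.IsFeasible w) : G.lagFun w ≤ Real.sqrt 3 / 18 := by
  obtain ⟨hw0, hw1⟩ := hw
  simp only [List.nodup_cons, List.mem_cons, List.not_mem_nil, not_or, or_false,
    not_false_eq_true, List.nodup_nil, and_true] at hnd
  simp only [List.mem_cons, List.not_mem_nil, or_false, forall_eq_or_imp, forall_eq] at hV
  obtain ⟨va, vb, vc₁, vd₁, vc₂, vd₂, vc₃, vd₃⟩ := hV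
  obtain ⟨⟨ab, ac₁, ad₁, ac₂, ad₂, ac₃, ad₃⟩, ⟨bc₁, bd₁, bc₂, bd₂, bc₃, bd₃⟩,
    ⟨n11, n12, n13, n14, n15⟩, ⟨n21, n22, n23, n24⟩, ⟨n31, n32, n33⟩, ⟨n41, n42⟩, n5⟩ := hnd
  set R := (G.verts.erase a).erase b with hR
  have hRV : ∀ v ∈ R, v ∈ G.verts := fun v hv =>
    Finset.mem_of_mem_erase (Finset.mem_of_mem_erase hv)
  have haR : a ∉ R := by simp [hR]
  have hbR : b ∉ R := by simp [hR]
  have hsum : w a + w b + ∑ v ∈ R, w v = 1 := by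
    rw [← hw1, ← Finset.add_sum_erase _ _ va,
      ← Finset.add_sum_erase (G.verts.erase a) _ (Finset.mem_erase.2 ⟨Ne.symm ab, vb⟩)]
    ring
  have hwR : ∀ v ∈ R, 0 ≤ w v := fun v hv => hw0 v (hRV v hv)
  -- the six vertices
  have hsub : ({c₁, d₁, c₂, d₂, c₃, d₃} : Finset ℕ) ⊆ R := by
    intro v hv
    simp only [Finset.mem_insert, Finset.mem_singleton] at hv
    simp only [hR, Finset.mem_erase]
    rcases hv with rfl | rfl | rfl | rfl | rfl | rfl <;>
      refine ⟨Ne.symm ?_, Ne.symm ?_, ?_⟩ <;> assumption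
  have six : ∀ f : ℕ → ℝ, ∑ v ∈ ({c₁, d₁, c₂, d₂, c₃, d₃} : Finset ℕ), f v
      = f c₁ + f d₁ + f c₂ + f d₂ + f c₃ + f d₃ := by
    intro f
    rw [Finset.sum_insert, Finset.sum_insert, Finset.sum_insert, Finset.sum_insert,
      Finset.sum_insert, Finset.sum_singleton]
    · ring
    all_goals simp only [Finset.mem_insert, Finset.mem_singleton, not_or]; tauto
  have hS1 : w c₁ + w d₁ + w c₂ + w d₂ + w c₃ + w d₃ ≤ ∑ v ∈ R, w v := by
    rw [← six w]
    exact Finset.sum_le_sum_of_subset_of_nonneg hsub fun v hv _ => hwR v hv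
  have hS2 : w c₁ ^ 2 + w d₁ ^ 2 + w c₂ ^ 2 + w d₂ ^ 2 + w c₃ ^ 2 + w d₃ ^ 2
      ≤ ∑ v ∈ R, w v ^ 2 := by
    rw [← six fun v => w v ^ 2]
    exact Finset.sum_le_sum_of_subset_of_nonneg hsub fun v hv _ => sq_nonneg _
  have hes := aux_esymm_two R w
  -- splitting
  have split : G.lagFun w
      = (∑ e ∈ G.edges with a ∈ e ∧ b ∈ e, ∏ v ∈ e, w v)
      + (∑ e ∈ G.edges with a ∈ e ∧ b ∉ e, ∏ v ∈ e, w v)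
      + (∑ e ∈ G.edges with a ∉ e ∧ b ∈ e, ∏ v ∈ e, w v)
      + (∑ e ∈ G.edges with a ∉ e ∧ b ∉ e, ∏ v ∈ e, w v) := by
    unfold HyperGraph.lagFun
    rw [← Finset.sum_filter_add_sum_filter_not G.edges (fun e => a ∈ e),
      ← Finset.sum_filter_add_sum_filter_not (G.edges.filter (fun e => a ∈ e)) (fun e => b ∈ e),
      ← Finset.sum_filter_add_sum_filter_not (G.edges.filter (fun e => a ∉ e)) (fun e => b ∈ e)]
    simp only [Finset.filter_filter]
    ring
  have hsubR : ∀ e ∈ G.edges, (e.erase a).erase b ⊆ R := fun e he =>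
    Finset.erase_subset_erase _ (Finset.erase_subset_erase _ (G.edges_sub e he))
  have hprod : ∀ P ∈ R.powersetCard 2, 0 ≤ ∏ v ∈ P, w v := fun P hP =>
    Finset.prod_nonneg fun v hv => hwR v ((Finset.mem_powersetCard.1 hP).1 hv)
  have b1 : (∑ e ∈ G.edges with a ∈ e ∧ b ∈ e, ∏ v ∈ e, w v) ≤ w a * w b * ∑ v ∈ R, w v := by
    have hval : ∀ d ∈ R, ∏ v ∈ ({a, b, d} : Finset ℕ), w v = w a * w b * w d := by
      intro d hd
      have h1 : a ≠ d := fun h => haR (h ▸ hd)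
      have h2 : b ≠ d := fun h => hbR (h ▸ hd)
      rw [Finset.prod_insert (by simp [ab, h1]), Finset.prod_pair h2]
      ring
    rw [Finset.mul_sum, ← Finset.sum_congr rfl hval]
    refine aux_sum_le _ R (fun d => ({a, b, d} : Finset ℕ)) (fun e => ∏ v ∈ e, w v) ?_ ?_
    · intro e he
      rw [Finset.mem_filter] at he
      obtain ⟨he, hae, hbe⟩ := he
      have hb' : b ∈ e.erase a := Finset.mem_erase.2 ⟨Ne.symm ab, hbe⟩
      have hc : ((e.erase a).erase b).card = 1 := by
        rw [Finset.card_erase_of_mem hb', Finset.card_erase_of_mem hae, G.card_eq e he]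
      obtain ⟨d, hd⟩ := Finset.card_eq_one.1 hc
      refine ⟨d, hsubR e he (by simp [hd]), ?_⟩
      change insert a (insert b {d}) = e
      rw [← hd, Finset.insert_erase hb', Finset.insert_erase hae]
    · intro d hd
      rw [hval d hd]
      exact mul_nonneg (mul_nonneg (hw0 a va) (hw0 b vb)) (hwR d hd)
  have bgen : ∀ (z : ℕ), z ∈ G.verts → z ∉ R → ∀ E : Finset (Finset ℕ),
      (∀ e ∈ E, e ∈ G.edges ∧ z ∈ e ∧ e.erase z ⊆ R) →
      (∑ e ∈ E, ∏ v ∈ e, w v) ≤ w z * ∑ P ∈ R.powersetCard 2, ∏ v ∈ P, w v := by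
    intro z hz hzR E hEz
    have hval : ∀ P ∈ R.powersetCard 2, ∏ v ∈ insert z P, w v = w z * ∏ v ∈ P, w v := by
      intro P hP
      exact Finset.prod_insert fun h => hzR ((Finset.mem_powersetCard.1 hP).1 h)
    rw [Finset.mul_sum, ← Finset.sum_congr rfl hval]
    refine aux_sum_le _ _ (fun P => insert z P) (fun e => ∏ v ∈ e, w v) ?_ ?_
    · intro e he
      obtain ⟨h1, h2, h3⟩ := hEz e he
      refine ⟨e.erase z, Finset.mem_powersetCard.2 ⟨h3, ?_⟩, Finset.insert_erase h2⟩
      rw [Finset.card_erase_of_mem h2, G.card_eq e h1]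
    · intro P hP
      rw [hval P hP]
      exact mul_nonneg (hw0 z hz) (hprod P hP)
  have b2 := bgen a va haR (G.edges.filter fun e => a ∈ e ∧ b ∉ e) (by
    intro e he
    rw [Finset.mem_filter] at he
    refine ⟨he.1, he.2.1, ?_⟩
    have := hsubR e he.1
    rwa [Finset.erase_eq_of_notMem (fun h => he.2.2 (Finset.mem_of_mem_erase h))] at this)
  have b3 := bgen b vb hbR (G.edges.filter fun e => a ∉ e ∧ b ∈ e) (by
    intro e he
    rw [Finset.mem_filter] at he
    refine ⟨he.1, he.2.2, ?_⟩
    have := hsubR e he.1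
    rwa [Finset.erase_eq_of_notMem he.2.1] at this)
  have b4 : (∑ e ∈ G.edges with a ∉ e ∧ b ∉ e, ∏ v ∈ e, w v)
      ≤ (w c₁ + w d₁) * (w c₂ + w d₂) * (w c₃ + w d₃) := by
    have hne : ∀ d ∈ ({c₁, d₁} : Finset ℕ) ×ˢ (({c₂, d₂} : Finset ℕ) ×ˢ ({c₃, d₃} : Finset ℕ)),
        d.1 ≠ d.2.1 ∧ d.1 ≠ d.2.2 ∧ d.2.1 ≠ d.2.2 ∧ 0 ≤ w d.1 ∧ 0 ≤ w d.2.1 ∧ 0 ≤ w d.2.2 := by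
      rintro ⟨x, y, z⟩ hd
      simp only [Finset.mem_product, Finset.mem_insert, Finset.mem_singleton] at hd
      obtain ⟨h1, h2, h3⟩ := hd
      rcases h1 with rfl | rfl <;> rcases h2 with rfl | rfl <;> rcases h3 with rfl | rfl <;>
        refine ⟨?_, ?_, ?_, hw0 _ ?_, hw0 _ ?_, hw0 _ ?_⟩ <;> assumption
    have hval : ∀ d ∈ ({c₁, d₁} : Finset ℕ) ×ˢ (({c₂, d₂} : Finset ℕ) ×ˢ ({c₃, d₃} : Finset ℕ)),
        ∏ v ∈ ({d.1, d.2.1, d.2.2} : Finset ℕ), w v = w d.1 * (w d.2.1 * w d.2.2) := by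
      intro d hd
      obtain ⟨h1, h2, h3, -⟩ := hne d hd
      rw [Finset.prod_insert (by simp [h1, h2]), Finset.prod_pair h3]
    have htot : ∑ d ∈ ({c₁, d₁} : Finset ℕ) ×ˢ (({c₂, d₂} : Finset ℕ) ×ˢ ({c₃, d₃} : Finset ℕ)),
        w d.1 * (w d.2.1 * w d.2.2) = (w c₁ + w d₁) * (w c₂ + w d₂) * (w c₃ + w d₃) := by
      simp only [Finset.sum_product, Finset.sum_pair n11, Finset.sum_pair n31, Finset.sum_pair n5]
      ring
    rw [← htot, ← Finset.sum_congr rfl hval]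
    refine aux_sum_le _ _ (fun d : ℕ × ℕ × ℕ => ({d.1, d.2.1, d.2.2} : Finset ℕ))
      (fun e => ∏ v ∈ e, w v) ?_ ?_
    · intro e he
      rw [Finset.mem_filter] at he
      obtain ⟨he, hae, hbe⟩ := he
      obtain ⟨h1, h2, h3⟩ := hE e he hae hbe
      have e1 : ∃ x ∈ ({c₁, d₁} : Finset ℕ), x ∈ e := by simpa using h1
      have e2 : ∃ x ∈ ({c₂, d₂} : Finset ℕ), x ∈ e := by simpa using h2
      have e3 : ∃ x ∈ ({c₃, d₃} : Finset ℕ), x ∈ e := by simpa using h3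
      obtain ⟨x, hx, hxe⟩ := e1
      obtain ⟨y, hy, hye⟩ := e2
      obtain ⟨z, hz, hze⟩ := e3
      have hm : (x, y, z) ∈ ({c₁, d₁} : Finset ℕ) ×ˢ
          (({c₂, d₂} : Finset ℕ) ×ˢ ({c₃, d₃} : Finset ℕ)) :=
        Finset.mem_product.2 ⟨hx, Finset.mem_product.2 ⟨hy, hz⟩⟩
      refine ⟨(x, y, z), hm, ?_⟩
      obtain ⟨m1, m2, m3, -⟩ := hne _ hm
      apply Finset.eq_of_subset_of_card_le
      · intro v hv
        simp only [Finset.mem_insert, Finset.mem_singleton] at hv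
        rcases hv with rfl | rfl | rfl <;> assumption
      · rw [G.card_eq e he]
        exact (Finset.card_eq_three.2 ⟨x, y, z, m1, m2, m3, rfl⟩).ge
    · intro d hd
      rw [hval d hd]
      obtain ⟨-, -, -, h1, h2, h3⟩ := hne d hd
      exact mul_nonneg h1 (mul_nonneg h2 h3)
  have hfin := aux_ineq (w a) (w b) (∑ v ∈ R, w v) (w c₁ + w d₁) (w c₂ + w d₂) (w c₃ + w d₃)
    (hw0 a va) (hw0 b vb) (Finset.sum_nonneg hwR)
    (add_nonneg (hw0 _ vc₁) (hw0 _ vd₁)) (add_nonneg (hw0 _ vc₂) (hw0 _ vd₂))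
    (add_nonneg (hw0 _ vc₃) (hw0 _ vd₃)) hsum (by linarith)
  have hQ : ((w c₁ + w d₁) ^ 2 + (w c₂ + w d₂) ^ 2 + (w c₃ + w d₃) ^ 2) / 2
      ≤ ∑ v ∈ R, w v ^ 2 := by
    nlinarith [sq_nonneg (w c₁ - w d₁), sq_nonneg (w c₂ - w d₂), sq_nonneg (w c₃ - w d₃)]
  have hpair : (w a + w b) * (∑ P ∈ R.powersetCard 2, ∏ v ∈ P, w v) ≤
      (w a + w b) * (((∑ v ∈ R, w v) ^ 2
        - ((w c₁ + w d₁) ^ 2 + (w c₂ + w d₂) ^ 2 + (w c₃ + w d₃) ^ 2) / 2) / 2) :=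
    mul_le_mul_of_nonneg_left (by linarith) (add_nonneg (hw0 a va) (hw0 b vb))
  rw [split]
  linarith

/-- In a `K43e`-free graph, every edge meets every copy of `K_4^3`. -/
theorem aux_meet (G : ThreeGraph) (hfree : G.Free K43e) (a b c d : ℕ)
    (hnd : [a, b, c, d].Nodup)
    (h1 : {a, b, c} ∈ G.edges) (h2 : {a, b, d} ∈ G.edges) (h3 : {a, c, d} ∈ G.edges)
    (h4 : {b, c, d} ∈ G.edges) (e : Finset ℕ) (he : e ∈ G.edges) (ha : a ∉ e) (hb : b ∉ e) :
    c ∈ e ∨ d ∈ e := by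
  by_contra hcon
  push Not at hcon
  obtain ⟨hc, hd⟩ := hcon
  obtain ⟨x, y, z, xy, xz, yz, rfl⟩ := Finset.card_eq_three.1 (G.card_eq e he)
  apply hfree
  have va := G.edges_sub _ h1 (show a ∈ ({a, b, c} : Finset ℕ) by simp)
  have vb := G.edges_sub _ h1 (show b ∈ ({a, b, c} : Finset ℕ) by simp)
  have vc := G.edges_sub _ h1 (show c ∈ ({a, b, c} : Finset ℕ) by simp)
  have vd := G.edges_sub _ h2 (show d ∈ ({a, b, d} : Finset ℕ) by simp)
  have vx := G.edges_sub _ he (show x ∈ ({x, y, z} : Finset ℕ) by simp)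
  have vy := G.edges_sub _ he (show y ∈ ({x, y, z} : Finset ℕ) by simp)
  have vz := G.edges_sub _ he (show z ∈ ({x, y, z} : Finset ℕ) by simp)
  simp only [List.nodup_cons, List.mem_cons, List.not_mem_nil, not_or, or_false,
    not_false_eq_true, List.nodup_nil, and_true] at hnd
  simp only [Finset.mem_insert, Finset.mem_singleton, not_or] at ha hb hc hd
  let f : ℕ → ℕ := fun n =>
    if n = 1 then a else if n = 2 then b else if n = 3 then c else if n = 4 then d
    else if n = 5 then x else if n = 6 then y else z
  have f1 : f 1 = a := rfl
  have f2 : f 2 = b := rfl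
  have f3 : f 3 = c := rfl
  have f4 : f 4 = d := rfl
  have f5 : f 5 = x := rfl
  have f6 : f 6 = y := rfl
  have f7 : f 7 = z := rfl
  refine ⟨f, ?_, ?_, ?_⟩
  · intro m hm n hn hmn
    simp only [K43e, Finset.coe_insert, Finset.coe_singleton, Set.mem_insert_iff,
      Set.mem_singleton_iff] at hm hn
    rcases hm with rfl | rfl | rfl | rfl | rfl | rfl | rfl <;>
      rcases hn with rfl | rfl | rfl | rfl | rfl | rfl | rfl <;>
      first
        | rfl
        | (exfalso; simp only [f1, f2, f3, f4, f5, f6, f7] at hmn; grind)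
  · intro v hv
    simp only [K43e, Finset.mem_insert, Finset.mem_singleton] at hv
    rcases hv with rfl | rfl | rfl | rfl | rfl | rfl | rfl <;> assumption
  · intro s hs
    simp only [K43e, Finset.mem_insert, Finset.mem_singleton] at hs
    rcases hs with rfl | rfl | rfl | rfl | rfl <;>
      simp only [Finset.image_insert, Finset.image_singleton, f1, f2, f3, f4, f5, f6, f7] <;>
      assumption

/-- A dense `K_4^3 ∪ e`-free 3-graph with Lagrangian greater than `√3/18` is `X_3`-free. -/
theorem dense_K43e_free_X3_free (G : ThreeGraph) (hdense : G.LagDense)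
    (hfree : G.Free K43e) (hlag : Real.sqrt 3 / 18 < G.lag) : G.Free X3 := by
  rintro ⟨f, hinj, hv, he⟩
  refine absurd hlag (not_lt.2 ?_)
  have hne : ∀ m ∈ X3.verts, ∀ n ∈ X3.verts, m ≠ n → f m ≠ f n := fun m hm n hn h h' =>
    h (hinj hm hn h')
  have hnd : ([1, 2, 3, 4, 5, 6, 7, 8].map f).Nodup := by
    refine List.Nodup.map_on ?_ (by decide)
    intro m hm n hn h
    exact hinj (by simpa [X3] using hm) (by simpa [X3] using hn) h
  have hE : ∀ i j k : ℕ, ({i, j, k} : Finset ℕ) ∈ X3.edges →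
      ({f i, f j, f k} : Finset ℕ) ∈ G.edges := by
    intro i j k h
    simpa [Finset.image_insert] using he _ h
  refine Real.sSup_le ?_ (by positivity)
  rintro r ⟨w, hw, rfl⟩
  have hsl : ∀ l : List ℕ, l.Sublist [1, 2, 3, 4, 5, 6, 7, 8] → (l.map f).Nodup := fun l hl =>
    hnd.sublist (hl.map f)
  refine aux_bound G (f 1) (f 2) (f 3) (f 4) (f 5) (f 6) (f 7) (f 8) hnd ?_ ?_ w hw
  · intro v hv'
    obtain ⟨m, hm, rfl⟩ := List.mem_map.1 (show v ∈ [1, 2, 3, 4, 5, 6, 7, 8].map f from hv')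
    exact hv m (by simpa [X3] using hm)
  · intro e hee ha hb
    refine ⟨?_, ?_, ?_⟩
    · exact aux_meet G hfree _ _ _ _ (hsl [1, 2, 3, 4] (by decide)) (hE _ _ _ (by decide))
        (hE _ _ _ (by decide)) (hE _ _ _ (by decide)) (hE _ _ _ (by decide)) e hee ha hb
    · exact aux_meet G hfree _ _ _ _ (hsl [1, 2, 5, 6] (by decide)) (hE _ _ _ (by decide))
        (hE _ _ _ (by decide)) (hE _ _ _ (by decide)) (hE _ _ _ (by decide)) e hee ha hb
    · exact aux_meet G hfree _ _ _ _ (hsl [1, 2, 7, 8] (by decide)) (hE _ _ _ (by decide))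
        (hE _ _ _ (by decide)) (hE _ _ _ (by decide)) (hE _ _ _ (by decide)) e hee ha hb
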